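/- arXiv:2510.13071 — 2 statements merged into one kernel-verified Lean document; each statement's English description precedes it below -/
import Mathlib

section
/- Let N ≤ N̂ be sequences of nonnegative real matrices on the same alphabets, i.e. (N_i)_{ab} ≤ (N̂_i)_{ab} for all i and all entries. Then a sequence w is N̂/N-distinguished — that is, w ∈ V_N and for every i ≥ 0 the limit lim_{n→∞} N̂_i^n w_{n+1} exists — if and only if w ∈ V_N and liminf_{n→∞} ‖N̂_i^n w_{n+1}‖ < ∞ for infinitely many i. -/
open Filter Topology Matrix

noncomputable section

/-- The product `N_k N_{k+1} ⋯ N_{k+m}` of a nonstationary sequence of matrices,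
i.e. the matrix written `N_k^n` (with `n = k + m`) in the paper. -/
def matProd {A : ℕ → Type} [∀ i, Fintype (A i)]
    (N : ∀ i, Matrix (A i) (A (i + 1)) ℝ) (k : ℕ) :
    ∀ m : ℕ, Matrix (A k) (A (k + m + 1)) ℝ
  | 0 => N k
  | m + 1 => matProd N k m * N (k + m + 1)

/-- `V_N^0`: nonnegative fixed-point sequences (`w_i ∈ C_i`, `w_i = N_i w_{i+1}`). -/
def V0 {A : ℕ → Type} [∀ i, Fintype (A i)] (N : ∀ i, Matrix (A i) (A (i + 1)) ℝ) :
    Set (∀ i, A i → ℝ) :=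
  {w | (∀ i a, 0 ≤ w i a) ∧ ∀ i, w i = (N i).mulVec (w (i + 1))}

/-- `V_N`: nonnegative eigenvector sequences of eigenvalue one (never zero). -/
def Vpos {A : ℕ → Type} [∀ i, Fintype (A i)] (N : ∀ i, Matrix (A i) (A (i + 1)) ℝ) :
    Set (∀ i, A i → ℝ) := {w | w ∈ V0 N ∧ ∀ i, w i ≠ 0}

/-- `V_N^Δ`: members of `V_N` whose initial vector lies in the unit simplex `Δ₀`
(for the `L¹` norm `‖u‖ = ∑ₐ |u a|`). -/
def VDelta {A : ℕ → Type} [∀ i, Fintype (A i)] (N : ∀ i, Matrix (A i) (A (i + 1)) ℝ) :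
    Set (∀ i, A i → ℝ) := {w | w ∈ Vpos N ∧ ∑ a, |w 0 a| = 1}

/-- The sequence `N` is primitive: for every `k` there is `n > k` (here `n = k + m`, `m ≥ 1`)
such that every entry of `N_k^n` is strictly positive. -/
def Primitive {A : ℕ → Type} [∀ i, Fintype (A i)] (N : ∀ i, Matrix (A i) (A (i + 1)) ℝ) : Prop :=
  ∀ k, ∃ m, 0 < m ∧ ∀ (a : A k) (b : A (k + m + 1)), 0 < matProd N k m a b

theorem matProd_nonneg {A : ℕ → Type} [∀ i, Fintype (A i)]
    {N : ∀ i, Matrix (A i) (A (i + 1)) ℝ} (hN : ∀ i a b, 0 ≤ N i a b) (k m : ℕ) :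
    ∀ a b, 0 ≤ matProd N k m a b := by
  induction m with
  | zero => exact hN k
  | succ m ih =>
    intro a b
    exact Finset.sum_nonneg fun c _ => mul_nonneg (ih a c) (hN _ c b)

theorem matProd_succ_mulVec {A : ℕ → Type} [∀ i, Fintype (A i)]
    (N : ∀ i, Matrix (A i) (A (i + 1)) ℝ) (k m : ℕ) (v : ∀ i, A i → ℝ) :
    (matProd N k (m + 1)).mulVec (v (k + (m + 1) + 1)) =
      (matProd N k m).mulVec ((N (k + m + 1)).mulVec (v (k + m + 1 + 1))) :=
  (Matrix.mulVec_mulVec _ _ _).symm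

/-- Splitting off the leftmost factor of a product, stated on vectors so that no transport
between alphabets is needed. -/
theorem matProd_succ_mulVec_left {A : ℕ → Type} [∀ i, Fintype (A i)]
    (N : ∀ i, Matrix (A i) (A (i + 1)) ℝ) (k m : ℕ) (v : ∀ i, A i → ℝ) :
    (matProd N k (m + 1)).mulVec (v (k + (m + 1) + 1)) =
      (N k).mulVec ((matProd N (k + 1) m).mulVec (v (k + 1 + m + 1))) := by
  induction m generalizing v with
  | zero => exact matProd_succ_mulVec N k 0 v
  | succ m ih =>
    rw [matProd_succ_mulVec N k (m + 1) v, matProd_succ_mulVec N (k + 1) m v]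
    exact ih fun j => (N j).mulVec (v (j + 1))

theorem monotone_matProd_mulVec {A : ℕ → Type} [∀ i, Fintype (A i)]
    {N Nh : ∀ i, Matrix (A i) (A (i + 1)) ℝ} (hNh : ∀ i a b, 0 ≤ Nh i a b)
    (hle : ∀ i a b, N i a b ≤ Nh i a b) {w : ∀ i, A i → ℝ} (hw : w ∈ V0 N) (i : ℕ) :
    Monotone fun m => (matProd Nh i m).mulVec (w (i + m + 1)) := by
  refine monotone_nat_of_le_succ fun m => ?_
  rw [matProd_succ_mulVec Nh i m w, hw.2 (i + m + 1)]
  intro a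
  refine Finset.sum_le_sum fun b _ => mul_le_mul_of_nonneg_left ?_ (matProd_nonneg hNh i m a b)
  exact Finset.sum_le_sum fun c _ => mul_le_mul_of_nonneg_right (hle _ b c) (hw.1 _ c)

theorem exists_tendsto_of_liminf_lt_top {α : Type*} [Fintype α] {f : ℕ → α → ℝ}
    (hf : Monotone f)
    (h : Filter.liminf (fun m => ENNReal.ofReal (∑ a, |f m a|)) atTop < ⊤) :
    ∃ u, Tendsto f atTop (𝓝 u) := by
  obtain ⟨C, hC, hC'⟩ := exists_between h
  have hfreq : ∃ᶠ m in atTop, ENNReal.ofReal (∑ a, |f m a|) < C :=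
    frequently_lt_of_liminf_lt (by isBoundedDefault) hC
  have hbdd (a : α) : BddAbove (Set.range fun m => f m a) := by
    refine ⟨C.toReal, ?_⟩
    rintro _ ⟨n, rfl⟩
    obtain ⟨m, hnm, hm⟩ := frequently_atTop.1 hfreq n
    calc f n a ≤ f m a := hf hnm a
      _ ≤ |f m a| := le_abs_self _
      _ ≤ ∑ b, |f m b| :=
        Finset.single_le_sum (f := fun b => |f m b|) (fun b _ => abs_nonneg _) (Finset.mem_univ a)
      _ ≤ C.toReal := (ENNReal.ofReal_le_iff_le_toReal hC'.ne).1 hm.le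
  exact ⟨fun a => ⨆ m, f m a, tendsto_pi_nhds.2 fun a =>
    tendsto_atTop_ciSup (fun _ _ hmn => hf hmn a) (hbdd a)⟩

theorem exists_tendsto_matProd_mulVec_of_succ {A : ℕ → Type} [∀ i, Fintype (A i)]
    {N : ∀ i, Matrix (A i) (A (i + 1)) ℝ} {w : ∀ i, A i → ℝ} {i : ℕ}
    (h : ∃ u, Tendsto (fun m => (matProd N (i + 1) m).mulVec (w (i + 1 + m + 1))) atTop (𝓝 u)) :
    ∃ u, Tendsto (fun m => (matProd N i m).mulVec (w (i + m + 1))) atTop (𝓝 u) := by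
  obtain ⟨u, hu⟩ := h
  refine ⟨(N i).mulVec u, (tendsto_add_atTop_iff_nat 1).1 ?_⟩
  simp only [matProd_succ_mulVec_left N i _ w]
  have hc : Continuous fun v => (N i).mulVec v := by fun_prop
  exact (hc.tendsto u).comp hu

/-- for `N ≤ N̂` (entrywise, on the same alphabets), a sequence `w` is
`N̂/N`-distinguished — i.e. `w ∈ V_N` and all limits `lim_n N̂_i^n w_{n+1}` exist — iff
`w ∈ V_N` and `liminf_n ‖N̂_i^n w_{n+1}‖ < ∞` for infinitely many `i`
(L¹ norm; the liminf is taken in `ℝ≥0∞`). -/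
theorem statement18 (A : ℕ → Type) [∀ i, Fintype (A i)] [∀ i, Nonempty (A i)]
    (N Nh : ∀ i, Matrix (A i) (A (i + 1)) ℝ)
    (hN0 : ∀ i a b, 0 ≤ N i a b)
    (hle : ∀ i a b, N i a b ≤ Nh i a b)
    (w : ∀ i, A i → ℝ) :
    (w ∈ Vpos N ∧ ∀ i, ∃ u : A i → ℝ,
        Tendsto (fun m => (matProd Nh i m).mulVec (w (i + m + 1))) atTop (𝓝 u)) ↔
    (w ∈ Vpos N ∧ ∃ᶠ i in atTop,
        Filter.liminf
          (fun m => ENNReal.ofReal (∑ a, |((matProd Nh i m).mulVec (w (i + m + 1))) a|))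
          atTop < ⊤) := by
  refine and_congr_right fun hw => ⟨fun h => Frequently.of_forall fun i => ?_, fun h i => ?_⟩
  · obtain ⟨u, hu⟩ := h i
    have hc : Continuous fun v : A i → ℝ => ENNReal.ofReal (∑ a, |v a|) :=
      ENNReal.continuous_ofReal.comp (by fun_prop)
    have hlim := ((hc.tendsto u).comp hu).liminf_eq
    simp only [Function.comp_def] at hlim
    rw [hlim]
    exact ENNReal.ofReal_lt_top
  · have hNh : ∀ i a b, 0 ≤ Nh i a b := fun i a b => (hN0 i a b).trans (hle i a b)
    obtain ⟨j, hij, hj⟩ := frequently_atTop.1 h i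
    have hlim := exists_tendsto_of_liminf_lt_top (monotone_matProd_mulVec hNh hle hw.1 j) hj
    clear hj
    induction j, hij using Nat.le_induction with
    | base => exact hlim
    | succ j _ ih => exact ih (exists_tendsto_matProd_mulVec_of_succ hlim)
end
end

section
/- For i ≥ 0 let N_i = [[a_i, c_i],[0, b_i]] be real 2×2 matrices with a_i, b_i > 0 and c_i ≥ 0. Write a_0^k = a_0 a_1 ⋯ a_k and b_0^k = b_0 b_1 ⋯ b_k, and define w_0 = 1 and w_{k+1} = (b_0^k)^{-1}, the unique normalized nonnegative eigenvector sequence of eigenvalue one for the scalar sequence (b_i). Then the limits lim_{n→∞} N_i^n (0, w_{n+1})^T exist for every i ≥ 0 (i.e. w is N/(b)-distinguished) if and only if ∑_{k≥0} (a_0^k / b_0^k)(c_k / a_k) < ∞. In the special case where a_i ≥ b_i and c_i = a_i − b_i for all i, this sum converges if and only if limsup_{n→∞} a_0^n / b_0^n < ∞. -/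
open Filter Topology Matrix

noncomputable section

/-- The 2×2 triangular matrices `N_i = [[a_i, c_i],[0, b_i]]`. -/
def triMat (a b c : ℕ → ℝ) : ∀ _ : ℕ, Matrix (Fin 2) (Fin 2) ℝ :=
  fun i => Matrix.of ![![a i, c i], ![0, b i]]

/-- The term `(a_0^k / b_0^k) (c_k / a_k)` of the series. -/
def triTerm (a b c : ℕ → ℝ) (k : ℕ) : ℝ :=
  ((∏ j ∈ Finset.range (k + 1), a j) / (∏ j ∈ Finset.range (k + 1), b j)) * (c k / a k)

/-- The summand in terms of products over initial segments. -/
lemma triTerm_eq (a b c : ℕ → ℝ) (ha : ∀ i, 0 < a i) (k : ℕ) :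
    triTerm a b c k =
      (∏ j ∈ Finset.range k, a j) * c k / ∏ j ∈ Finset.range (k + 1), b j := by
  have := (ha k).ne'
  rw [triTerm, Finset.prod_range_succ a]
  field_simp

lemma triTerm_nonneg (a b c : ℕ → ℝ) (ha : ∀ i, 0 < a i) (hb : ∀ i, 0 < b i)
    (hc : ∀ i, 0 ≤ c i) (k : ℕ) : 0 ≤ triTerm a b c k :=
  mul_nonneg (div_nonneg (Finset.prod_nonneg fun j _ => (ha j).le)
    (Finset.prod_nonneg fun j _ => (hb j).le)) (div_nonneg (hc k) (ha k).le)

lemma triMat_mulVec (a b c : ℕ → ℝ) (i : ℕ) (x y : ℝ) :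
    (triMat a b c i).mulVec ![x, y] = ![a i * x + c i * y, b i * y] := by
  ext j
  fin_cases j <;> simp [triMat, Matrix.mulVec, dotProduct, Fin.sum_univ_two]

lemma matProd_triMat_mulVec_fst (a b c : ℕ → ℝ) (ha : ∀ i, 0 < a i) (i m : ℕ) (x : ℝ) :
    (matProd (A := fun _ => Fin 2) (triMat a b c) i m).mulVec ![x, 0] =
      ![(∏ j ∈ Finset.range (i + m + 1), a j) / (∏ j ∈ Finset.range i, a j) * x, 0] := by
  have h0 : (∏ j ∈ Finset.range i, a j) ≠ 0 := Finset.prod_ne_zero_iff.2 fun j _ => (ha j).ne'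
  induction m generalizing x with
  | zero =>
    rw [matProd, triMat_mulVec, add_zero, Finset.prod_range_succ, mul_div_cancel_left₀ _ h0]
    simp
  | succ m ih =>
    rw [matProd, ← Matrix.mulVec_mulVec, triMat_mulVec, mul_zero, mul_zero, add_zero, ih,
      show i + (m + 1) + 1 = i + m + 1 + 1 by ring, Finset.prod_range_succ a (i + m + 1)]
    congr 1
    ring

/-- The first coordinate of `N_i^n (0, w_{n+1})ᵀ` is a rescaled block of partial sums of the
series, and the second one is constant. -/
lemma matProd_triMat_mulVec_snd (a b c : ℕ → ℝ) (ha : ∀ i, 0 < a i) (w : ℕ → ℝ)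
    (hb : ∀ i, 0 < b i) (hw : ∀ k, w k = (∏ j ∈ Finset.range k, b j)⁻¹) (i m : ℕ) :
    (matProd (A := fun _ => Fin 2) (triMat a b c) i m).mulVec ![0, w (i + m + 1)] =
      ![(∑ j ∈ Finset.range (m + 1), triTerm a b c (i + j)) / (∏ j ∈ Finset.range i, a j),
        w i] := by
  have h0 : (∏ j ∈ Finset.range i, a j) ≠ 0 := Finset.prod_ne_zero_iff.2 fun j _ => (ha j).ne'
  have hbw (k : ℕ) : b k * w (k + 1) = w k := by
    have := (hb k).ne'
    rw [hw, hw, Finset.prod_range_succ, _root_.mul_inv_rev, mul_inv_cancel_left₀ this]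
  induction m with
  | zero =>
    rw [matProd, triMat_mulVec, add_zero, hbw, zero_add, Finset.sum_range_one, add_zero,
      triTerm_eq a b c ha, hw (i + 1)]
    congr 1
    field_simp
    ring
  | succ m ih =>
    have hsplit : ![a (i + m + 1) * 0 + c (i + m + 1) * w (i + (m + 1) + 1), w (i + m + 1)] =
        ![c (i + m + 1) * w (i + m + 1 + 1), 0] + ![0, w (i + m + 1)] := by
      ext j
      fin_cases j <;> simp [add_assoc]
    rw [matProd, ← Matrix.mulVec_mulVec, triMat_mulVec]
    have hb' : b (i + m + 1) * w (i + (m + 1) + 1) = w (i + m + 1) := hbw (i + m + 1)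
    rw [hb', hsplit, Matrix.mulVec_add, ih, matProd_triMat_mulVec_fst a b c ha,
      Finset.sum_range_succ _ (m + 1), ← add_assoc i m 1, triTerm_eq a b c ha (i + m + 1),
      hw (i + m + 1 + 1)]
    ext j
    fin_cases j
    · simp
      field_simp
      ring
    · simp

lemma sum_triTerm_of_eq_sub (a b c : ℕ → ℝ) (ha : ∀ i, 0 < a i) (hb : ∀ i, 0 < b i)
    (hc : ∀ i, c i = a i - b i) (n : ℕ) :
    ∑ k ∈ Finset.range n, triTerm a b c k =
      (∏ j ∈ Finset.range n, a j) / (∏ j ∈ Finset.range n, b j) - 1 := by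
  induction n with
  | zero => simp
  | succ n ih =>
    have h0 : (∏ j ∈ Finset.range n, b j) ≠ 0 := Finset.prod_ne_zero_iff.2 fun j _ => (hb j).ne'
    have h1 := (hb n).ne'
    rw [Finset.sum_range_succ, ih, triTerm_eq a b c ha, hc, Finset.prod_range_succ a,
      Finset.prod_range_succ b]
    field_simp
    ring

lemma limsup_ofReal_lt_top_iff {r : ℕ → ℝ} (hr : Monotone r) :
    limsup (fun n => ENNReal.ofReal (r n)) atTop < ⊤ ↔ BddAbove (Set.range r) := by
  constructor
  · intro h
    obtain ⟨C, hC, hCtop⟩ := exists_between h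
    obtain ⟨N, hN⟩ := eventually_atTop.1 (eventually_lt_of_limsup_lt hC)
    refine ⟨C.toReal, ?_⟩
    rintro _ ⟨n, rfl⟩
    exact (hr (le_max_right N n)).trans
      ((ENNReal.ofReal_le_iff_le_toReal hCtop.ne).1 (hN _ (le_max_left N n)).le)
  · rintro ⟨C, hC⟩
    refine lt_of_le_of_lt (limsup_le_of_le (a := ENNReal.ofReal C) (by isBoundedDefault) ?_)
      ENNReal.ofReal_lt_top
    exact Eventually.of_forall fun n => ENNReal.ofReal_le_ofReal (hC ⟨n, rfl⟩)

/-- for `N_i = [[a_i, c_i],[0, b_i]]` with `a_i, b_i > 0`, `c_i ≥ 0`, and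
`w_0 = 1`, `w_{k+1} = (b_0^k)⁻¹` the normalized eigenvector sequence of eigenvalue one for
`(b_i)`, the limits `lim_n N_i^n (0, w_{n+1})ᵀ` exist for every `i` (i.e. `w` is
`N/(b)`-distinguished) iff `∑ₖ (a_0^k/b_0^k)(c_k/a_k) < ∞`; and in the special case
`a_i ≥ b_i`, `c_i = a_i − b_i`, this sum converges iff `limsup_n a_0^n/b_0^n < ∞`. -/
theorem statement19 (a b c : ℕ → ℝ)
    (ha : ∀ i, 0 < a i) (hb : ∀ i, 0 < b i) (hc : ∀ i, 0 ≤ c i)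
    (w : ℕ → ℝ) (hw0 : w 0 = 1)
    (hw : ∀ k, w (k + 1) = (∏ j ∈ Finset.range (k + 1), b j)⁻¹) :
    ((∀ i, ∃ u : Fin 2 → ℝ,
        Tendsto (fun m => (matProd (A := fun _ => Fin 2) (triMat a b c) i m).mulVec
          ![0, w (i + m + 1)]) atTop (𝓝 u)) ↔
      Summable (triTerm a b c)) ∧
    ((∀ i, b i ≤ a i) → (∀ i, c i = a i - b i) →
      (Summable (triTerm a b c) ↔
        Filter.limsup (fun n => ENNReal.ofReal
          ((∏ j ∈ Finset.range (n + 1), a j) / (∏ j ∈ Finset.range (n + 1), b j)))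
          atTop < ⊤)) := by
  have hw' (k : ℕ) : w k = (∏ j ∈ Finset.range k, b j)⁻¹ := by
    cases k with
    | zero => simp [hw0]
    | succ k => exact hw k
  have hnn := triTerm_nonneg a b c ha hb hc
  refine ⟨?_, fun _ hcab => ?_⟩
  · simp only [matProd_triMat_mulVec_snd a b c ha w hb hw']
    constructor
    · intro h
      obtain ⟨u, hu⟩ := h 0
      have hu0 := tendsto_pi_nhds.1 hu 0
      simp only [Matrix.cons_val_zero, Finset.range_zero, Finset.prod_empty, div_one,
        zero_add] at hu0
      exact ((hasSum_iff_tendsto_nat_of_nonneg hnn _).2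
        ((tendsto_add_atTop_iff_nat 1).1 hu0)).summable
    · intro h i
      have hi : Summable fun j => triTerm a b c (i + j) := by
        simpa only [add_comm i] using (summable_nat_add_iff i).2 h
      refine ⟨![(∑' j, triTerm a b c (i + j)) / (∏ j ∈ Finset.range i, a j), w i],
        tendsto_pi_nhds.2 fun j => ?_⟩
      fin_cases j
      · exact ((tendsto_add_atTop_iff_nat 1).2 hi.hasSum.tendsto_sum_nat).div_const _
      · exact tendsto_const_nhds
  · have hsum := sum_triTerm_of_eq_sub a b c ha hb hcab
    have hr (n : ℕ) : (∏ j ∈ Finset.range (n + 1), a j) / (∏ j ∈ Finset.range (n + 1), b j) =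
        ∑ k ∈ Finset.range (n + 1), triTerm a b c k + 1 := by
      rw [hsum, sub_add_cancel]
    have hmono : Monotone fun n => ∑ k ∈ Finset.range n, triTerm a b c k :=
      fun m n hmn => Finset.sum_le_sum_of_subset_of_nonneg (Finset.range_mono hmn)
        fun k _ _ => hnn k
    simp only [hr]
    rw [limsup_ofReal_lt_top_iff fun m n hmn => by
      simpa using hmono (Nat.succ_le_succ hmn)]
    constructor
    · intro h
      refine ⟨∑' k, triTerm a b c k + 1, ?_⟩
      rintro _ ⟨n, rfl⟩
      simpa using h.sum_le_tsum (Finset.range (n + 1)) fun k _ => hnn k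
    · rintro ⟨C, hC⟩
      refine summable_of_sum_range_le (c := C) hnn fun n => ?_
      have h1 := hC ⟨n, rfl⟩
      have h2 := hmono n.le_succ
      simp only [Nat.succ_eq_add_one] at h1 h2
      linarith
end
end
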